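/- Let K = (K_{j,i})_{j∈{1,…,c_out}, i∈{1,…,c_in}} be a multichannel convolution kernel, each K_{j,i}: ℤ² → ℝ finitely supported in {0,…,k−1}². For ω = (ω₁,ω₂) ∈ ℝ², let E(ω) ∈ ℂ^{c_out×c_in} have entries E(ω)_{j,i} = Σ_{k₁,k₂=0}^{k−1} e^{−i k₁ω₁} e^{−i k₂ω₂} K_{j,i}(k₁,k₂). Let n ≥ 1, c ∈ ℤ², and let T ∈ ℝ^{c_out n² × c_in n²} be the zero-padded convolution matrix with entries T_{(j,u),(i,u′)} = K_{j,i}(u′ − u + c) for u, u′ ∈ {0,…,n−1}². Then σ₁(T) ≤ sup_{ω∈[0,2π]²} σ₁(E(ω)). -/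

import Mathlib

open Matrix

/-- The spectral norm (largest singular value) of a real matrix, i.e. the operator norm
of the associated linear map between Euclidean spaces. -/
noncomputable def sigma1R {m n : Type*} [Fintype m] [Fintype n] [DecidableEq n]
    (A : Matrix m n ℝ) : ℝ :=
  ‖LinearMap.toContinuousLinearMap (Matrix.toEuclideanLin A)‖

/-- The spectral norm (largest singular value) of a complex matrix. -/
noncomputable def sigma1 {m n : Type*} [Fintype m] [Fintype n] [DecidableEq n]
    (A : Matrix m n ℂ) : ℝ :=
  ‖LinearMap.toContinuousLinearMap (Matrix.toEuclideanLin A)‖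

theorem aux_parseval {I U P : Type*} [Fintype I] [Fintype U] [DecidableEq U] [Fintype P]
    (φ : P → U → ℂ)
    (hφ : ∀ u v, ∑ p, (starRingEnd ℂ) (φ p u) * φ p v = if u = v then 1 else 0)
    (x : I × U → ℝ) :
    ∑ p, ∑ i, ‖∑ u, φ p u * (x (i, u) : ℂ)‖ ^ 2 = ∑ q, x q ^ 2 := by
  have h : ((∑ p, ∑ i, ‖∑ u, φ p u * (x (i, u) : ℂ)‖ ^ 2 : ℝ) : ℂ) = ((∑ q, x q ^ 2 : ℝ) : ℂ) := by
    push_cast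
    rw [Finset.sum_comm, Fintype.sum_prod_type]
    refine Finset.sum_congr rfl fun i _ => ?_
    calc ∑ p, ((‖∑ u, φ p u * (x (i, u) : ℂ)‖ : ℝ) : ℂ) ^ 2
        = ∑ p, ∑ u, ∑ v, (x (i, u) : ℂ) * (x (i, v) : ℂ) * ((starRingEnd ℂ) (φ p u) * φ p v) := by
          refine Finset.sum_congr rfl fun p _ => ?_
          rw [← Complex.conj_mul', map_sum, Finset.sum_mul_sum]
          refine Finset.sum_congr rfl fun u _ => Finset.sum_congr rfl fun v _ => ?_
          rw [map_mul, Complex.conj_ofReal]; ring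
      _ = ∑ u, ∑ v, (x (i, u) : ℂ) * (x (i, v) : ℂ) * ∑ p, ((starRingEnd ℂ) (φ p u) * φ p v) := by
          rw [Finset.sum_comm]
          refine Finset.sum_congr rfl fun u _ => ?_
          rw [Finset.sum_comm]
          simp only [Finset.mul_sum]
      _ = _ := by simp [hφ, sq]
  exact_mod_cast h

theorem aux_main {J I U P : Type*} [Fintype J] [Fintype I] [Fintype U] [Fintype P]
    [DecidableEq I] [DecidableEq U]
    (T : Matrix (J × U) (I × U) ℝ) (E : P → Matrix J I ℂ) (φ ψ : P → U → ℂ)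
    (hφ : ∀ u v, ∑ p, (starRingEnd ℂ) (φ p u) * φ p v = if u = v then 1 else 0)
    (hψ : ∀ u v, ∑ p, (starRingEnd ℂ) (ψ p u) * ψ p v = if u = v then 1 else 0)
    (hT : ∀ j i u v, (T (j, u) (i, v) : ℂ) =
      ∑ p, (starRingEnd ℂ) (ψ p u) * E p j i * φ p v)
    (M : ℝ) (hM0 : 0 ≤ M) (hM : ∀ p, sigma1 (E p) ≤ M) : sigma1R T ≤ M := by
  refine ContinuousLinearMap.opNorm_le_bound _ hM0 fun x => ?_
  set z : EuclideanSpace ℝ (J × U) := Matrix.toEuclideanLin T x with hz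
  have hzz : ∀ j u, z (j, u) = ∑ q, T (j, u) q * x q := fun j u => rfl
  change ‖z‖ ≤ M * ‖x‖
  let X : P → EuclideanSpace ℂ I := fun p => WithLp.toLp 2 fun i => ∑ u, φ p u * (x (i, u) : ℂ)
  let Z : P → EuclideanSpace ℂ J := fun p => WithLp.toLp 2 fun j => ∑ u, ψ p u * (z (j, u) : ℂ)
  have hX : ∑ p, ‖X p‖ ^ 2 = ‖x‖ ^ 2 := by
    simp only [EuclideanSpace.norm_sq_eq, X]
    rw [aux_parseval φ hφ (fun q => x q)]; simp
  have hZ : ∑ p, ‖Z p‖ ^ 2 = ‖z‖ ^ 2 := by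
    simp only [EuclideanSpace.norm_sq_eq, Z]
    rw [aux_parseval ψ hψ (fun q => z q)]; simp
  have key : ((‖z‖ ^ 2 : ℝ) : ℂ) = ∑ p, inner ℂ (Z p) (Matrix.toEuclideanLin (E p) (X p)) := by
    have e1 : ∀ p, inner ℂ (Z p) (Matrix.toEuclideanLin (E p) (X p)) =
        ∑ j, ∑ u, ∑ i, ∑ v, (z (j, u) : ℂ) * ((starRingEnd ℂ) (ψ p u) * E p j i * φ p v) * (x (i, v) : ℂ) := by
      intro p
      rw [PiLp.inner_apply]
      refine Finset.sum_congr rfl fun j _ => ?_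
      have : (Matrix.toEuclideanLin (E p) (X p)) j = ∑ i, E p j i * ∑ v, φ p v * (x (i, v) : ℂ) := rfl
      rw [RCLike.inner_apply, this]
      simp only [Z, map_sum, map_mul, Complex.conj_ofReal]
      rw [mul_comm, Finset.sum_mul]
      refine Finset.sum_congr rfl fun u _ => ?_
      rw [Finset.mul_sum]
      refine Finset.sum_congr rfl fun i _ => ?_
      rw [Finset.mul_sum, Finset.mul_sum]
      refine Finset.sum_congr rfl fun v _ => ?_
      ring
    simp only [e1]
    rw [Finset.sum_comm, EuclideanSpace.norm_sq_eq, Fintype.sum_prod_type]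
    push_cast
    refine Finset.sum_congr rfl fun j _ => ?_
    rw [Finset.sum_comm]
    refine Finset.sum_congr rfl fun u _ => ?_
    rw [Finset.sum_comm]
    have : ((‖z (j, u)‖ : ℝ) : ℂ) ^ 2 = (z (j, u) : ℂ) * (z (j, u) : ℂ) := by
      rw [Real.norm_eq_abs, ← sq, ← Complex.ofReal_pow, sq_abs, Complex.ofReal_pow]
    rw [this]
    nth_rewrite 2 [hzz]
    rw [Fintype.sum_prod_type]
    push_cast
    rw [Finset.mul_sum]
    refine Finset.sum_congr rfl fun i _ => ?_
    rw [Finset.sum_comm, Finset.mul_sum]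
    refine Finset.sum_congr rfl fun v _ => ?_
    rw [hT, Finset.sum_mul, Finset.mul_sum]
    refine Finset.sum_congr rfl fun p _ => ?_
    ring
  have hb : ‖z‖ ^ 2 ≤ M * (‖z‖ * ‖x‖) := by
    have h1 : ‖z‖ ^ 2 = ‖((‖z‖ ^ 2 : ℝ) : ℂ)‖ := by
      rw [Complex.norm_real, Real.norm_of_nonneg (sq_nonneg _)]
    rw [h1, key]
    calc _ ≤ ∑ p, ‖inner ℂ (Z p) (Matrix.toEuclideanLin (E p) (X p))‖ := norm_sum_le _ _
      _ ≤ ∑ p, M * (‖Z p‖ * ‖X p‖) := by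
        refine Finset.sum_le_sum fun p _ => ?_
        have h2 : ‖Matrix.toEuclideanLin (E p) (X p)‖ ≤ M * ‖X p‖ :=
          (ContinuousLinearMap.le_of_opNorm_le
            (LinearMap.toContinuousLinearMap (Matrix.toEuclideanLin (E p))) (hM p) (X p))
        calc _ ≤ ‖Z p‖ * ‖Matrix.toEuclideanLin (E p) (X p)‖ := norm_inner_le_norm _ _
          _ ≤ ‖Z p‖ * (M * ‖X p‖) := by gcongr
          _ = _ := by ring
      _ = M * ∑ p, ‖Z p‖ * ‖X p‖ := by rw [Finset.mul_sum]
      _ ≤ M * (‖z‖ * ‖x‖) := by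
        gcongr
        refine (Real.sum_mul_le_sqrt_mul_sqrt _ _ _).trans ?_
        rw [hX, hZ, Real.sqrt_sq (norm_nonneg _), Real.sqrt_sq (norm_nonneg _)]
  rcases (norm_nonneg z).eq_or_lt with h0 | h0
  · rw [← h0]; positivity
  · refine le_of_mul_le_mul_left ?_ h0
    nlinarith

/-- normalized characters -/
noncomputable def auxE (N : ℕ) (a : Fin N) (s : ℤ) : ℂ :=
  Complex.exp (Complex.I * s * ((2 * Real.pi * a / N : ℝ) : ℂ)) / (Real.sqrt N : ℂ)

theorem auxE_conj (N : ℕ) (a : Fin N) (s : ℤ) : (starRingEnd ℂ) (auxE N a s) =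
    Complex.exp (-Complex.I * s * ((2 * Real.pi * a / N : ℝ) : ℂ)) / (Real.sqrt N : ℂ) := by
  unfold auxE
  rw [map_div₀, ← Complex.exp_conj, Complex.conj_ofReal, map_mul, map_mul, Complex.conj_ofReal,
    Complex.conj_I, map_intCast]

theorem auxE_conj_mul (N : ℕ) (a : Fin N) (s : ℤ) (k : ℕ) :
    (starRingEnd ℂ) (auxE N a s) *
      Complex.exp (-(Complex.I) * (k : ℂ) * ((2 * Real.pi * a / N : ℝ) : ℂ)) =
    (starRingEnd ℂ) (auxE N a (s + k)) := by
  rw [auxE_conj, auxE_conj, div_mul_eq_mul_div, ← Complex.exp_add]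
  congr 2
  push_cast
  ring

theorem auxE_orth (N : ℕ) (hN : 0 < N) (s t : ℤ) (h : |s - t| < N) :
    ∑ a, (starRingEnd ℂ) (auxE N a s) * auxE N a t = if s = t then 1 else 0 := by
  have hN' : (N : ℂ) ≠ 0 := by exact_mod_cast hN.ne'
  have hs : (Real.sqrt N : ℂ) * (Real.sqrt N : ℂ) = N := by
    rw [← Complex.ofReal_mul, Real.mul_self_sqrt (Nat.cast_nonneg _)]; simp
  set ζ : ℂ := Complex.exp (2 * Real.pi * Complex.I * ((t - s : ℤ) : ℂ) / N) with hζ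
  have e : ∀ a : Fin N, (starRingEnd ℂ) (auxE N a s) * auxE N a t = ζ ^ (a : ℕ) / N := by
    intro a
    rw [auxE_conj, auxE, div_mul_div_comm, hs, ← Complex.exp_add, hζ, ← Complex.exp_nat_mul]
    congr 2
    push_cast
    ring
  simp only [e]
  rw [← Finset.sum_div, Fin.sum_univ_eq_sum_range (fun a => ζ ^ a)]
  split_ifs with hst
  · have : ζ = 1 := by rw [hζ, hst]; simp
    simp [this, hN']
  · have h1 : ζ ≠ 1 := by
      intro h1
      rw [hζ, Complex.exp_eq_one_iff] at h1
      obtain ⟨m, hm⟩ := h1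
      have hpi : (2 * Real.pi * Complex.I : ℂ) ≠ 0 := Complex.two_pi_I_ne_zero
      have h2 : ((t - s : ℤ) : ℂ) = ((m * N : ℤ) : ℂ) := by
        rw [div_eq_iff hN'] at hm
        apply mul_left_cancel₀ hpi
        rw [hm]; push_cast; ring
      have h3 : t - s = m * N := by exact_mod_cast h2
      have h4 : (N : ℤ) ∣ s - t := ⟨-m, by linarith⟩
      have := Int.eq_zero_of_abs_lt_dvd h4 h
      omega
    have h2 : ζ ^ N = 1 := by
      rw [hζ, ← Complex.exp_nat_mul, mul_div_cancel₀ _ hN', Complex.exp_eq_one_iff]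
      exact ⟨t - s, by ring⟩
    rw [geom_sum_eq h1, h2]; simp

theorem auxE_orth2 (N : ℕ) (hN : 0 < N) (s t s' t' : ℤ) (h : |s - t| < N) (h' : |s' - t'| < N) :
    ∑ p : Fin N × Fin N, (starRingEnd ℂ) (auxE N p.1 s * auxE N p.2 s') *
      (auxE N p.1 t * auxE N p.2 t') = if s = t ∧ s' = t' then 1 else 0 := by
  have : ∀ p : Fin N × Fin N, (starRingEnd ℂ) (auxE N p.1 s * auxE N p.2 s') *
      (auxE N p.1 t * auxE N p.2 t') = ((starRingEnd ℂ) (auxE N p.1 s) * auxE N p.1 t) *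
      ((starRingEnd ℂ) (auxE N p.2 s') * auxE N p.2 t') := by
    intro p; rw [map_mul]; ring
  simp only [this]
  rw [Fintype.sum_prod_type]
  dsimp only
  rw [← Finset.sum_mul_sum, auxE_orth N hN s t h, auxE_orth N hN s' t' h']
  split_ifs <;> simp_all

theorem sigma1_continuous {m n : Type*} [Fintype m] [Fintype n] [DecidableEq n] :
    Continuous (fun A : Matrix m n ℂ => sigma1 A) := by
  let L : Matrix m n ℂ →ₗ[ℂ] (EuclideanSpace ℂ n →L[ℂ] EuclideanSpace ℂ m) :=
    (LinearMap.toContinuousLinearMap (𝕜 := ℂ) (E := EuclideanSpace ℂ n)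
      (F' := EuclideanSpace ℂ m)).toLinearMap ∘ₗ (Matrix.toEuclideanLin (𝕜 := ℂ)).toLinearMap
  have : Continuous L := L.continuous_of_finiteDimensional
  exact this.norm

/-- The spectral norm of a zero-padded convolution matrix is bounded by the supremum over
frequencies of the spectral norm of the spectral density matrix `E(ω)` of the kernel. -/
theorem spectral_norm_toeplitz_le_sup_density
    (cout cin k n : ℕ) (hcout : 1 ≤ cout) (hcin : 1 ≤ cin) (hn : 1 ≤ n)
    (K : Fin cout → Fin cin → ℤ × ℤ → ℝ)
    (hK : ∀ j i s, K j i s ≠ 0 → 0 ≤ s.1 ∧ s.1 < (k:ℤ) ∧ 0 ≤ s.2 ∧ s.2 < (k:ℤ))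
    (E : ℝ → ℝ → Matrix (Fin cout) (Fin cin) ℂ)
    (hE : ∀ (ω1 ω2 : ℝ) (j : Fin cout) (i : Fin cin),
      E ω1 ω2 j i = ∑ k1 : Fin k, ∑ k2 : Fin k,
        Complex.exp (-(Complex.I) * ((k1:ℕ):ℂ) * ω1) *
          Complex.exp (-(Complex.I) * ((k2:ℕ):ℂ) * ω2) *
          (K j i ((k1:ℤ), (k2:ℤ)) : ℂ))
    (c : ℤ × ℤ)
    (T : Matrix (Fin cout × Fin n × Fin n) (Fin cin × Fin n × Fin n) ℝ)
    (hT : ∀ (j : Fin cout) (i : Fin cin) (u u' : Fin n × Fin n),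
      T (j, u) (i, u') =
        K j i (((u'.1 : ℤ) - (u.1 : ℤ) + c.1, (u'.2 : ℤ) - (u.2 : ℤ) + c.2))) :
    sigma1R T ≤
      ⨆ ω1 : Set.Icc (0:ℝ) (2 * Real.pi), ⨆ ω2 : Set.Icc (0:ℝ) (2 * Real.pi),
        sigma1 (E ω1 ω2) := by
  have hcont : Continuous (fun w : ℝ × ℝ => sigma1 (E w.1 w.2)) := by
    refine sigma1_continuous.comp ?_
    refine continuous_pi fun j => continuous_pi fun i => ?_
    simp only [hE]
    fun_prop
  obtain ⟨C, hC⟩ := ((isCompact_Icc (a := (0:ℝ)) (b := 2 * Real.pi)).prod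
    (isCompact_Icc (a := (0:ℝ)) (b := 2 * Real.pi))).bddAbove_image hcont.continuousOn
  have hC' : ∀ ω1 ω2 : Set.Icc (0:ℝ) (2 * Real.pi), sigma1 (E ω1 ω2) ≤ C := fun ω1 ω2 =>
    hC ⟨((ω1 : ℝ), (ω2 : ℝ)), ⟨ω1.2, ω2.2⟩, rfl⟩
  have hpi : (0:ℝ) ≤ 2 * Real.pi := by positivity
  have : Nonempty (Set.Icc (0:ℝ) (2 * Real.pi)) := ⟨⟨0, le_refl _, hpi⟩⟩
  have hle : ∀ ω1 ω2 : Set.Icc (0:ℝ) (2 * Real.pi), sigma1 (E ω1 ω2) ≤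
      ⨆ ω1 : Set.Icc (0:ℝ) (2 * Real.pi), ⨆ ω2 : Set.Icc (0:ℝ) (2 * Real.pi),
        sigma1 (E ω1 ω2) := by
    intro ω1 ω2
    refine le_trans (le_ciSup (f := fun ω2 : Set.Icc (0:ℝ) (2 * Real.pi) => sigma1 (E ω1 ω2))
      ⟨C, ?_⟩ ω2) (le_ciSup (f := fun ω1 : Set.Icc (0:ℝ) (2 * Real.pi) =>
        ⨆ ω2 : Set.Icc (0:ℝ) (2 * Real.pi), sigma1 (E ω1 ω2)) ⟨C, ?_⟩ ω1)
    · rintro _ ⟨w, rfl⟩; exact hC' _ _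
    · rintro _ ⟨w, rfl⟩; exact ciSup_le fun _ => hC' _ _
  have hM0 : 0 ≤ ⨆ ω1 : Set.Icc (0:ℝ) (2 * Real.pi), ⨆ ω2 : Set.Icc (0:ℝ) (2 * Real.pi),
        sigma1 (E ω1 ω2) :=
    Real.iSup_nonneg fun _ => Real.iSup_nonneg fun _ => norm_nonneg _
  obtain ⟨N, hNdef⟩ : ∃ N : ℕ, N = n + k + c.1.natAbs + c.2.natAbs + 1 := ⟨_, rfl⟩
  have hN : 0 < N := by omega
  have hmem : ∀ a : Fin N, (2 * Real.pi * a / N : ℝ) ∈ Set.Icc (0:ℝ) (2 * Real.pi) := by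
    intro a
    have hNr : (0:ℝ) < N := by exact_mod_cast hN
    refine ⟨by positivity, ?_⟩
    rw [div_le_iff₀ hNr]
    have : (a : ℝ) ≤ N := by exact_mod_cast a.2.le
    gcongr
  refine aux_main (P := Fin N × Fin N) T
    (fun p => E (2 * Real.pi * p.1 / N) (2 * Real.pi * p.2 / N))
    (fun p u => auxE N p.1 u.1 * auxE N p.2 u.2)
    (fun p u => auxE N p.1 (u.1 - c.1) * auxE N p.2 (u.2 - c.2)) ?_ ?_ ?_ _ hM0
    (fun p => hle ⟨_, hmem p.1⟩ ⟨_, hmem p.2⟩)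
  · rintro ⟨u1, u2⟩ ⟨v1, v2⟩
    rw [auxE_orth2 N hN _ _ _ _ (by rw [abs_lt]; simp only; omega) (by rw [abs_lt]; simp only; omega)]
    simp [Fin.ext_iff]
  · rintro ⟨u1, u2⟩ ⟨v1, v2⟩
    rw [auxE_orth2 N hN _ _ _ _ (by rw [abs_lt]; simp only; omega) (by rw [abs_lt]; simp only; omega)]
    simp [Fin.ext_iff]
  · rintro j i ⟨u1, u2⟩ ⟨v1, v2⟩
    have e1 : ∀ p : Fin N × Fin N,
        (starRingEnd ℂ) (auxE N p.1 ((u1 : ℕ) - c.1) * auxE N p.2 ((u2 : ℕ) - c.2)) *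
          E (2 * Real.pi * p.1 / N) (2 * Real.pi * p.2 / N) j i *
          (auxE N p.1 (v1 : ℕ) * auxE N p.2 (v2 : ℕ)) =
        ∑ k1 : Fin k, ∑ k2 : Fin k, (K j i ((k1:ℤ), (k2:ℤ)) : ℂ) *
          ((starRingEnd ℂ) (auxE N p.1 ((u1 : ℕ) - c.1 + (k1 : ℕ)) *
            auxE N p.2 ((u2 : ℕ) - c.2 + (k2 : ℕ))) *
          (auxE N p.1 (v1 : ℕ) * auxE N p.2 (v2 : ℕ))) := by
      intro p
      rw [hE, Finset.mul_sum, Finset.sum_mul]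
      refine Finset.sum_congr rfl fun k1 _ => ?_
      rw [Finset.mul_sum, Finset.sum_mul]
      refine Finset.sum_congr rfl fun k2 _ => ?_
      rw [map_mul, map_mul, ← auxE_conj_mul, ← auxE_conj_mul]
      ring
    simp only [e1]
    rw [Finset.sum_comm]
    have e2 : ∀ k1 k2 : Fin k, ∑ p : Fin N × Fin N, (K j i ((k1:ℤ), (k2:ℤ)) : ℂ) *
          ((starRingEnd ℂ) (auxE N p.1 ((u1 : ℕ) - c.1 + (k1 : ℕ)) *
            auxE N p.2 ((u2 : ℕ) - c.2 + (k2 : ℕ))) *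
          (auxE N p.1 (v1 : ℕ) * auxE N p.2 (v2 : ℕ))) =
        if ((k1:ℕ):ℤ) = (v1:ℕ) - (u1:ℕ) + c.1 ∧ ((k2:ℕ):ℤ) = (v2:ℕ) - (u2:ℕ) + c.2 then
          (K j i ((v1:ℕ) - (u1:ℕ) + c.1, (v2:ℕ) - (u2:ℕ) + c.2) : ℂ) else 0 := by
      intro k1 k2
      rw [← Finset.mul_sum, auxE_orth2 N hN _ _ _ _ (by rw [abs_lt]; omega)
        (by rw [abs_lt]; omega)]
      split_ifs with h1 h2 h2
      · rw [h2.1, h2.2, mul_one]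
      · exfalso; omega
      · exfalso; omega
      · simp
    have e3 : ∀ k1 : Fin k, ∑ p : Fin N × Fin N, ∑ k2 : Fin k, (K j i ((k1:ℤ), (k2:ℤ)) : ℂ) *
          ((starRingEnd ℂ) (auxE N p.1 ((u1 : ℕ) - c.1 + (k1 : ℕ)) *
            auxE N p.2 ((u2 : ℕ) - c.2 + (k2 : ℕ))) *
          (auxE N p.1 (v1 : ℕ) * auxE N p.2 (v2 : ℕ))) = _ := fun k1 => by
      rw [Finset.sum_comm]
    simp only [e3, e2]
    rw [hT]
    simp only
    by_cases h0 : K j i ((v1:ℕ) - (u1:ℕ) + c.1, (v2:ℕ) - (u2:ℕ) + c.2) = 0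
    · simp [h0]
    · obtain ⟨a1, a2, a3, a4⟩ := hK _ _ _ h0
      simp only at a1 a2 a3 a4
      obtain ⟨m1, hm1⟩ := Int.eq_ofNat_of_zero_le a1
      obtain ⟨m2, hm2⟩ := Int.eq_ofNat_of_zero_le a3
      rw [hm1, hm2]
      rw [Finset.sum_eq_single (⟨m1, by omega⟩ : Fin k), Finset.sum_eq_single (⟨m2, by omega⟩ : Fin k)]
      · simp
      · intro b _ hb
        rw [if_neg]
        rintro ⟨-, h⟩
        exact hb (Fin.ext (by exact_mod_cast h))
      · simp
      · intro b _ hb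
        refine Finset.sum_eq_zero fun b' _ => ?_
        rw [if_neg]
        rintro ⟨h, -⟩
        exact hb (Fin.ext (by exact_mod_cast h))
      · simp
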